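/- arXiv:0806.0482 — 2 statements merged into one kernel-verified Lean document; each statement's English description precedes it below -/
import Mathlib

section
/- Let d ≥ 1, let α : ℤ^d → ℝ be finitely supported with α̂ vanishing nowhere on ℝ^d, and let β ∈ ℓ¹(ℤ^d) be its convolution inverse (α * β equals the Kronecker delta at 0). Let s ∈ ℕ and Γ := (2s+1)ℤ^d, and define matrices indexed by Q_s × Q_s by A_Q(j,k) := Σ_{p∈Γ} α_{j−k+p} and B_Q(j,k) := Σ_{p∈Γ} β_{j−k+p}. Then B_Q A_Q = A_Q B_Q = Id on ℂ^{Q_s}, and the column sum norm of B_Q satisfies ‖B_Q‖₁ = max_{k∈Q_s} Σ_{j∈Q_s} |B_Q(j,k)| ≤ Σ_{n∈ℤ^d} |β_n|. -/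
open Matrix

noncomputable section

/-- The discrete cube `Q_s = {-s,…,s}^d ⊂ ℤ^d`, as a type. -/
abbrev DCube (d s : ℕ) := Fin d → (Set.Icc (-(s : ℤ)) (s : ℤ))

/-- Inclusion of the cube into `ℤ^d`. -/
def DCube.emb {d s : ℕ} (m : DCube d s) : Fin d → ℤ := fun i => (m i : ℤ)

/-- The Fourier transform `α̂(θ) = ∑_k α_k e^{-i⟨k,θ⟩}` of a (finitely supported)
sequence `α : ℤ^d → ℝ`. -/
def fhat (d : ℕ) (α : (Fin d → ℤ) → ℝ) (θ : Fin d → ℝ) : ℂ :=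
  ∑ᶠ k : Fin d → ℤ, (α k : ℂ) * Complex.exp (-Complex.I * ∑ i, (k i : ℂ) * (θ i : ℂ))

/-- Every point of `ℤ^d` is uniquely a point of the cube plus a point of `(2s+1)ℤ^d`. -/
theorem DCube.bijective_emb_add (d s : ℕ) :
    Function.Bijective fun p : DCube d s × (Fin d → ℤ) =>
      (fun i => p.1.emb i + (2 * s + 1) * p.2 i : Fin d → ℤ) := by
  constructor
  · rintro ⟨j, n⟩ ⟨k, m⟩ h
    have key : ∀ i, j i = k i ∧ n i = m i := by
      intro i
      have hi : (j i : ℤ) + (2 * s + 1) * n i = (k i : ℤ) + (2 * s + 1) * m i := congrFun h i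
      obtain ⟨j1, j2⟩ := (j i).2
      obtain ⟨k1, k2⟩ := (k i).2
      have hnm : n i = m i := by
        by_contra hne
        rcases lt_or_gt_of_ne hne with hlt | hlt <;> nlinarith
      refine ⟨Subtype.ext ?_, hnm⟩
      rw [hnm] at hi
      linarith
    exact Prod.ext (funext fun i => (key i).1) (funext fun i => (key i).2)
  · intro m
    have hN : (0 : ℤ) < 2 * s + 1 := by positivity
    refine ⟨(fun i => ⟨(m i + s) % (2 * s + 1) - s, ?_⟩, fun i => (m i + s) / (2 * s + 1)), ?_⟩
    · have h1 := Int.emod_nonneg (m i + s) hN.ne'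
      have h2 := Int.emod_lt_of_pos (m i + s) hN
      constructor <;> linarith
    · funext i
      have := Int.emod_add_mul_ediv (m i + s) (2 * s + 1)
      simp only [DCube.emb]
      linarith

/-- The decomposition `ℤ^d = Q_s + (2s+1)ℤ^d` as an equivalence. -/
def DCube.tiling (d s : ℕ) : DCube d s × (Fin d → ℤ) ≃ (Fin d → ℤ) :=
  Equiv.ofBijective _ (DCube.bijective_emb_add d s)

theorem DCube.tiling_apply {d s : ℕ} (l : DCube d s) (n : Fin d → ℤ) :
    DCube.tiling d s (l, n) = l.emb + (2 * s + 1 : ℤ) • n := rfl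

/-- The periodization of `f` over the lattice `Nℤ^d`. -/
def periodization {d : ℕ} (N : ℤ) (f : (Fin d → ℤ) → ℝ) (m : Fin d → ℤ) : ℝ :=
  ∑' n : Fin d → ℤ, f (m + N • n)

theorem periodization_add_smul {d : ℕ} (N : ℤ) (f : (Fin d → ℤ) → ℝ) (m n : Fin d → ℤ) :
    periodization N f (m + N • n) = periodization N f m := by
  unfold periodization
  rw [← (Equiv.addLeft n).tsum_eq fun n' => f (m + N • n')]
  simp [smul_add, add_assoc]

theorem summable_comp_add_smul {d : ℕ} {N : ℤ} (hN : N ≠ 0) {f : (Fin d → ℤ) → ℝ}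
    (hf : Summable f) (m : Fin d → ℤ) : Summable fun n => f (m + N • n) :=
  hf.comp_injective fun _ _ h => smul_right_injective _ hN (add_left_cancel h)

theorem abs_periodization_le {d : ℕ} {N : ℤ} (hN : N ≠ 0) {f : (Fin d → ℤ) → ℝ}
    (hf : Summable fun n => |f n|) (m : Fin d → ℤ) :
    |periodization N f m| ≤ periodization N (fun n => |f n|) m := by
  have hs : Summable fun n => ‖f (m + N • n)‖ := by
    simpa only [Real.norm_eq_abs] using summable_comp_add_smul hN hf m
  simpa only [Real.norm_eq_abs, periodization] using norm_tsum_le_tsum_norm hs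

/-- Summing over the cube and then over the lattice is summing over `ℤ^d`. -/
theorem sum_periodization_sub {d s : ℕ} {f : (Fin d → ℤ) → ℝ} (hf : Summable f)
    (c : Fin d → ℤ) :
    ∑ j : DCube d s, periodization (2 * s + 1) f (j.emb - c) = ∑' m, f m := by
  have hf' : Summable fun p => f (DCube.tiling d s p - c) :=
    ((DCube.tiling d s).trans (Equiv.subRight c)).summable_iff.mpr hf
  rw [← ((DCube.tiling d s).trans (Equiv.subRight c)).tsum_eq f]
  simp only [Equiv.trans_apply, Equiv.subRight_apply]
  rw [hf'.tsum_prod, tsum_fintype]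
  simp only [periodization, DCube.tiling_apply, sub_add_eq_add_sub]

/-- Circulant convolution with a periodization is convolution on `ℤ^d`. -/
theorem sum_periodization_mul_periodization {d s : ℕ} {f : (Fin d → ℤ) → ℝ}
    (hf : (Function.support f).Finite) (g : (Fin d → ℤ) → ℝ) (j k : Fin d → ℤ) :
    ∑ l : DCube d s, periodization (2 * s + 1) f (j - l.emb) *
        periodization (2 * s + 1) g (l.emb - k) =
      ∑' m, f m * periodization (2 * s + 1) g (j - k - m) := by
  have hs : Summable fun m => f m * periodization (2 * s + 1) g (j - k - m) :=
    summable_of_hasFiniteSupport (hf.subset (Function.support_mul_subset_left _ _))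
  have hs' := ((DCube.tiling d s).trans (Equiv.subLeft j)).summable_iff.mpr hs
  rw [← ((DCube.tiling d s).trans (Equiv.subLeft j)).tsum_eq]
  simp only [Function.comp_def] at hs'
  rw [hs'.tsum_prod, tsum_fintype]
  refine Finset.sum_congr rfl fun l _ => ?_
  have hper : ∀ n : Fin d → ℤ, periodization (2 * s + 1) g
      (j - k - (j - (l.emb + (2 * s + 1 : ℤ) • n))) =
        periodization (2 * s + 1) g (l.emb - k) := fun n => by
    rw [← periodization_add_smul _ _ (l.emb - k) n]
    congr 1
    abel
  simp only [Equiv.trans_apply, Equiv.subLeft_apply, DCube.tiling_apply, hper, tsum_mul_right]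
  congr 1
  rw [periodization, ← (Equiv.neg (Fin d → ℤ)).tsum_eq]
  refine tsum_congr fun n => ?_
  congr 1
  simp only [Equiv.neg_apply, smul_neg]
  abel

/-- If `g` is a convolution inverse of the finitely supported `f`, then convolving the
periodization of `g` with `f` gives the periodization of the Kronecker delta. -/
theorem tsum_mul_periodization {d : ℕ} {N : ℤ} (hN : N ≠ 0) {f g : (Fin d → ℤ) → ℝ}
    (hf : (Function.support f).Finite) (hg : Summable g)
    (hconv : ∀ m, (∑ᶠ k, f k * g (m - k)) = if m = 0 then 1 else 0) (c : Fin d → ℤ) :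
    ∑' m, f m * periodization N g (c - m) = ∑' n : Fin d → ℤ, if c + N • n = 0 then 1 else 0 := by
  have hsupp : ∀ h : (Fin d → ℤ) → ℝ, ∀ m ∉ hf.toFinset, f m * h m = 0 := fun h m hm => by
    simp_all
  rw [tsum_eq_sum (hsupp _)]
  simp only [periodization, ← tsum_mul_left]
  rw [← Summable.tsum_finsetSum fun m _ => (summable_comp_add_smul hN hg _).mul_left _]
  refine tsum_congr fun n => ?_
  rw [← hconv, finsum_eq_sum_of_support_subset (s := hf.toFinset)]
  · refine Finset.sum_congr rfl fun m _ => ?_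
    rw [sub_add_eq_add_sub]
  · rw [hf.coe_toFinset]
    exact Function.support_mul_subset_left _ _

theorem DCube.tsum_delta_sub {d s : ℕ} (j k : DCube d s) :
    (∑' n : Fin d → ℤ, if j.emb - k.emb + (2 * s + 1 : ℤ) • n = 0 then (1 : ℝ) else 0) =
      (1 : Matrix (DCube d s) (DCube d s) ℝ) j k := by
  have hiff : ∀ n : Fin d → ℤ, j.emb - k.emb + (2 * s + 1 : ℤ) • n = 0 ↔ j = k ∧ n = 0 := by
    intro n
    have h : j.emb - k.emb + (2 * s + 1 : ℤ) • n = 0 ↔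
        DCube.tiling d s (j, n) = DCube.tiling d s (k, 0) := by
      rw [DCube.tiling_apply, DCube.tiling_apply, smul_zero, add_zero, sub_add_eq_add_sub,
        sub_eq_zero]
    rw [h, (DCube.tiling d s).apply_eq_iff_eq, Prod.mk.injEq]
  simp only [hiff, Matrix.one_apply]
  by_cases hjk : j = k <;> simp [hjk]

/-- **Periodized (multi-dimensional circulant) matrices are mutually inverse**: if
`α : ℤ^d → ℝ` is finitely supported with nowhere vanishing Fourier transform and
`β ∈ ℓ¹(ℤ^d)` is its convolution inverse (`α * β = δ_0`), `Γ = (2s+1)ℤ^d`, and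
`A_Q(j,k) = ∑_{p∈Γ} α_{j-k+p}`, `B_Q(j,k) = ∑_{p∈Γ} β_{j-k+p}` on `Q_s × Q_s`
(`Γ` parametrised as `p = (2s+1)n`, `n ∈ ℤ^d`), then `B_Q A_Q = A_Q B_Q = Id` and the
column sum norm of `B_Q` satisfies `‖B_Q‖₁ ≤ ∑_n |β_n|`. -/
theorem circulant_periodization_inverse
    (d : ℕ) (hd : 1 ≤ d)
    (α : (Fin d → ℤ) → ℝ) (hαfin : (Function.support α).Finite)
    (hαhat : ∀ θ : Fin d → ℝ, fhat d α θ ≠ 0)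
    (β : (Fin d → ℤ) → ℝ) (hβ : Summable fun n => |β n|)
    (hβconv : ∀ m : Fin d → ℤ,
      (∑ᶠ k : Fin d → ℤ, α k * β (m - k)) = if m = 0 then 1 else 0)
    (s : ℕ)
    (AQ BQ : Matrix (DCube d s) (DCube d s) ℝ)
    (hAQ : ∀ j k : DCube d s,
      AQ j k = ∑ᶠ n : Fin d → ℤ, α (fun i => j.emb i - k.emb i + (2 * s + 1) * n i))
    (hBQ : ∀ j k : DCube d s,
      BQ j k = ∑' n : Fin d → ℤ, β (fun i => j.emb i - k.emb i + (2 * s + 1) * n i)) :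
    BQ * AQ = 1 ∧ AQ * BQ = 1 ∧
      ∀ k : DCube d s, ∑ j : DCube d s, |BQ j k| ≤ ∑' n, |β n| := by
  have hN : (2 * s + 1 : ℤ) ≠ 0 := by positivity
  have hA : ∀ j k : DCube d s, AQ j k = periodization (2 * s + 1) α (j.emb - k.emb) := by
    intro j k
    rw [hAQ, periodization, tsum_eq_finsum]
    · rfl
    · exact hαfin.preimage
        (fun _ _ _ _ h => smul_right_injective _ hN (add_left_cancel h))
  have hB : ∀ j k : DCube d s, BQ j k = periodization (2 * s + 1) β (j.emb - k.emb) := hBQ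
  have hAB : AQ * BQ = 1 := by
    ext j k
    simp only [Matrix.mul_apply, hA, hB]
    rw [sum_periodization_mul_periodization hαfin,
      tsum_mul_periodization hN hαfin hβ.of_abs hβconv, DCube.tsum_delta_sub]
  refine ⟨mul_eq_one_comm.mp hAB, hAB, fun k => ?_⟩
  rw [← sum_periodization_sub (s := s) hβ k.emb]
  refine Finset.sum_le_sum fun j _ => ?_
  rw [hB]
  exact abs_periodization_le hN hβ _

end
end

section
/- Let Q be a finite set with L = |Q| elements, let B be an invertible real L×L matrix indexed by Q × Q with inverse A, and let f : ℝ → [0,∞) be continuously differentiable with compact support and ∫_ℝ f = 1. Define k : ℝ^Q → [0,∞) by k(η) := Π_{p∈Q} f((Bη)_p). Then for every j ∈ Q, ∫_{ℝ^{Q∖{j}}} ( sup_{η_j ∈ ℝ} k(η) ) dη^{⊥j} ≤ |det A| · ( Σ_{m∈Q} |B(m,j)| ) · ∫_ℝ |f'(x)| dx, where the integral is over the remaining L−1 coordinates η^{⊥j} = (η_m)_{m∈Q, m≠j}. -/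
open MeasureTheory Matrix

/-- A nonnegative integrable function whose derivative is dominated by an integrable function `G`
is bounded by the integral of `G`. -/
lemma iSup_le_integral_of_abs_deriv_le {g g' G : ℝ → ℝ}
    (hg : ∀ t, HasDerivAt g (g' t) t) (hgi : Integrable g) (hg' : Continuous g')
    (hGi : Integrable G) (hG : ∀ t, |g' t| ≤ G t) :
    ⨆ t, g t ≤ ∫ t, G t := by
  have hg'i : Integrable g' :=
    hGi.mono' hg'.aestronglyMeasurable (Filter.Eventually.of_forall hG)
  refine ciSup_le fun a => ?_
  have hlim := tendsto_zero_of_hasDerivAt_of_integrableOn_Iic (a := a) (fun x _ => hg x)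
    hg'i.integrableOn hgi.integrableOn
  have hint := integral_Iic_of_hasDerivAt_of_tendsto' (a := a) (fun x _ => hg x)
    hg'i.integrableOn hlim
  rw [sub_zero] at hint
  rw [← hint]
  calc ∫ x in Set.Iic a, g' x ≤ ∫ x in Set.Iic a, G x :=
        integral_mono hg'i.integrableOn hGi.integrableOn fun x => (le_abs_self _).trans (hG x)
    _ ≤ ∫ x, G x := setIntegral_le_integral hGi
        (Filter.Eventually.of_forall fun x => (abs_nonneg _).trans (hG x))

lemma measurePreserving_funUnique_symm {ι : Type*} [Unique ι] [hι : Fintype ι] :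
    MeasurePreserving (MeasurableEquiv.funUnique ι ℝ).symm volume volume := by
  obtain rfl : hι = Unique.fintype := Subsingleton.elim _ _
  exact (volume_preserving_funUnique ι ℝ).symm

section

variable {Q : Type*} [Fintype Q] [DecidableEq Q]

/-- Inserting a coordinate at position `j` preserves Lebesgue measure. -/
lemma measurePreserving_insertCoord (j : Q) :
    MeasurePreserving
      (fun (x : ({q : Q // q ≠ j} → ℝ) × ℝ) (q : Q) => if h : q = j then x.2 else x.1 ⟨q, h⟩)
      (volume.prod volume) volume := by
  let _ : Unique {q : Q // ¬ q ≠ j} := ⟨⟨⟨j, by simp⟩⟩, fun a => Subtype.ext (not_not.1 a.2)⟩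
  have h₁ := (volume_preserving_piEquivPiSubtypeProd (fun _ : Q => ℝ) (fun q => q ≠ j)).symm
  have h₂ := (MeasurePreserving.id (volume : Measure ({q : Q // q ≠ j} → ℝ))).prod
    (measurePreserving_funUnique_symm (ι := {q : Q // ¬ q ≠ j})
      (hι := Subtype.fintype fun q => ¬ q ≠ j))
  have h : (fun (x : ({q : Q // q ≠ j} → ℝ) × ℝ) (q : Q) =>
      if h : q = j then x.2 else x.1 ⟨q, h⟩) =
      (MeasurableEquiv.piEquivPiSubtypeProd (fun _ : Q => ℝ) (fun q => q ≠ j)).symm ∘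
        Prod.map id (MeasurableEquiv.funUnique {q : Q // ¬ q ≠ j} ℝ).symm := by
    funext x q
    by_cases h : q = j
    · simp [h, MeasurableEquiv.piEquivPiSubtypeProd, Equiv.piEquivPiSubtypeProd,
        MeasurableEquiv.funUnique]
    · simp [h, MeasurableEquiv.piEquivPiSubtypeProd, Equiv.piEquivPiSubtypeProd]
  rw [h]
  exact h₁.comp h₂

lemma map_mulVec_insertCoord {B : Matrix Q Q ℝ} (hB : B.det ≠ 0) (j : Q) :
    Measure.map (fun x : ({q : Q // q ≠ j} → ℝ) × ℝ =>
        B.mulVec fun q => if h : q = j then x.2 else x.1 ⟨q, h⟩) (volume.prod volume) =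
      ENNReal.ofReal |B.det⁻¹| • (volume : Measure (Q → ℝ)) := by
  rw [← Real.map_matrix_volume_pi_eq_smul_volume_pi hB, ← (measurePreserving_insertCoord j).map_eq,
    Measure.map_map (toLin' B).continuous_of_finiteDimensional.measurable
      (measurePreserving_insertCoord j).measurable]
  rfl

lemma prod_update_apply {R : Type*} [CommMonoid R] (f g : ℝ → R) (m : Q) (ω : Q → ℝ) :
    ∏ p, Function.update (fun _ : Q => f) m g p (ω p) =
      (∏ p ∈ Finset.univ.erase m, f (ω p)) * g (ω m) := by
  rw [← Finset.prod_erase_mul _ _ (Finset.mem_univ m), Function.update_self]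
  congr 1
  refine Finset.prod_congr rfl fun p hp => ?_
  rw [Function.update_of_ne (Finset.ne_of_mem_erase hp)]

lemma integrable_prod_erase_mul {f g : ℝ → ℝ} (hf : Integrable f) (hg : Integrable g) (m : Q) :
    Integrable fun ω : Q → ℝ => (∏ p ∈ Finset.univ.erase m, f (ω p)) * g (ω m) := by
  simp_rw [← prod_update_apply f g]
  refine Integrable.fintype_prod fun p => ?_
  by_cases hp : p = m
  · subst hp; simpa using hg
  · simpa [Function.update_of_ne hp] using hf

lemma integral_prod_erase_mul {f g : ℝ → ℝ} (hf : ∫ x, f x = 1) (m : Q) :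
    ∫ ω : Q → ℝ, (∏ p ∈ Finset.univ.erase m, f (ω p)) * g (ω m) = ∫ x, g x := by
  simp_rw [← prod_update_apply f g]
  rw [integral_fintype_prod_volume_eq_prod,
    ← Finset.prod_erase_mul _ _ (Finset.mem_univ m), Function.update_self, Finset.prod_eq_one,
    one_mul]
  intro p hp
  rw [Function.update_of_ne (Finset.ne_of_mem_erase hp), hf]

lemma hasDerivAt_mulVec_insertCoord (B : Matrix Q Q ℝ) (j : Q) (η' : {q : Q // q ≠ j} → ℝ)
    (p : Q) (t : ℝ) :
    HasDerivAt (fun t : ℝ => (B.mulVec fun q => if h : q = j then t else η' ⟨q, h⟩) p)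
      (B p j) t := by
  have key : ∀ q ∈ Finset.univ, HasDerivAt
      (fun t : ℝ => B p q * (if h : q = j then t else η' ⟨q, h⟩)) (if q = j then B p q else 0) t := by
    intro q _
    by_cases h : q = j
    · simpa [h] using (hasDerivAt_id t).const_mul (B p j)
    · simpa [h] using hasDerivAt_const t (B p q * η' ⟨q, h⟩)
  simpa [mulVec, dotProduct] using HasDerivAt.fun_sum key

end

/-- **The density estimate in the proof of Proposition 2 of the paper**: if `B` is an
invertible real `Q × Q` matrix with inverse `A`, `f ≥ 0` is a `C¹` density with compact
support, and `k(η) = ∏_{p∈Q} f((Bη)_p)` is the transformed joint density, then for each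
`j ∈ Q` the supremum of `k` over the coordinate `η_j`, integrated over the remaining
coordinates, is bounded by `|det A| (∑_m |B(m,j)|) ∫|f'|`. -/
theorem transformed_density_sup_estimate
    (Q : Type*) [Fintype Q] [DecidableEq Q]
    (B A : Matrix Q Q ℝ) (hBA : B * A = 1) (hAB : A * B = 1)
    (f : ℝ → ℝ) (hf0 : ∀ x, 0 ≤ f x)
    (hfC1 : ContDiff ℝ 1 f) (hfc : HasCompactSupport f)
    (hf1 : ∫ x, f x = 1)
    (j : Q) :
    ∫ η' : {q : Q // q ≠ j} → ℝ,
        ⨆ t : ℝ, ∏ p : Q,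
          f ((B.mulVec fun q => if h : q = j then t else η' ⟨q, h⟩) p) ≤
      |A.det| * (∑ m : Q, |B m j|) * ∫ x, |deriv f x| := by
  have hdet : B.det * A.det = 1 := by rw [← det_mul, hBA, det_one]
  have hB : B.det ≠ 0 := left_ne_zero_of_mul_eq_one hdet
  have hdetA : |B.det⁻¹| = |A.det| := by rw [inv_eq_of_mul_eq_one_right hdet]
  have hfi : Integrable f := hfC1.continuous.integrable_of_hasCompactSupport hfc
  have hf'c : Continuous (deriv f) := hfC1.continuous_deriv le_rfl
  have hf'i : Integrable fun x => |deriv f x| :=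
    (hf'c.integrable_of_hasCompactSupport hfc.deriv).abs
  set T : ({q : Q // q ≠ j} → ℝ) × ℝ → Q → ℝ := fun x =>
    B.mulVec fun q => if h : q = j then x.2 else x.1 ⟨q, h⟩ with hT
  have hTm : Measurable T := (toLin' B).continuous_of_finiteDimensional.measurable.comp
    (measurePreserving_insertCoord j).measurable
  have hTmap : Measure.map T (volume.prod volume) = ENNReal.ofReal |A.det| • volume := by
    rw [hT, map_mulVec_insertCoord hB j, hdetA]
  have hcomp : ∀ F : (Q → ℝ) → ℝ, Integrable F →
      Integrable (fun x => F (T x)) (volume.prod volume) := fun F hF => by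
    refine Integrable.comp_measurable ?_ hTm
    rw [hTmap]
    exact hF.smul_measure ENNReal.ofReal_ne_top
  let H : (Q → ℝ) → ℝ := fun ω =>
    ∑ m, |B m j| * ((∏ p ∈ Finset.univ.erase m, f (ω p)) * |deriv f (ω m)|)
  have hHm : ∀ m ∈ Finset.univ, Integrable fun ω : Q → ℝ =>
      |B m j| * ((∏ p ∈ Finset.univ.erase m, f (ω p)) * |deriv f (ω m)|) := fun m _ =>
    (integrable_prod_erase_mul hfi hf'i m).const_mul _
  have hH : Integrable H := integrable_finsetSum _ hHm
  have hHint : ∫ ω, H ω = (∑ m, |B m j|) * ∫ x, |deriv f x| := by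
    simp_rw [H]
    rw [integral_finsetSum _ hHm, Finset.sum_mul]
    refine Finset.sum_congr rfl fun m _ => ?_
    rw [integral_const_mul, integral_prod_erase_mul (g := fun x => |deriv f x|) hf1]
  have hHT := hcomp H hH
  have hKT := hcomp (fun ω => ∏ p, f (ω p)) (Integrable.fintype_prod fun _ => hfi)
  calc _ ≤ ∫ η' : {q : Q // q ≠ j} → ℝ, ∫ t : ℝ, H (T (η', t)) := by
        refine integral_mono_of_nonneg
          (Filter.Eventually.of_forall fun η' =>
            Real.iSup_nonneg fun t => Finset.prod_nonneg fun p _ => hf0 _)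
          hHT.integral_prod_left ?_
        filter_upwards [hHT.prod_right_ae, hKT.prod_right_ae] with η' hHη hKη
        have hd : ∀ p t, HasDerivAt (fun t => T (η', t) p) (B p j) t :=
          hasDerivAt_mulVec_insertCoord B j η'
        have hTc : ∀ p, Continuous fun t => T (η', t) p := fun p =>
          continuous_iff_continuousAt.2 fun t => (hd p t).continuousAt
        refine iSup_le_integral_of_abs_deriv_le (g' := fun t => ∑ m,
            (∏ p ∈ Finset.univ.erase m, f (T (η', t) p)) • (deriv f (T (η', t) m) * B m j))
          (fun t => HasDerivAt.fun_finsetProd fun p _ =>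
            ((hfC1.differentiable one_ne_zero _).hasDerivAt.comp t (hd p t))) hKη ?_ hHη ?_
        · exact continuous_finsetSum _ fun m _ =>
            (continuous_finsetProd _ fun p _ => hfC1.continuous.comp (hTc p)).smul
              ((hf'c.comp (hTc m)).mul continuous_const)
        · intro t
          refine (Finset.abs_sum_le_sum_abs _ _).trans (Finset.sum_le_sum fun m _ => le_of_eq ?_)
          rw [smul_eq_mul, abs_mul, abs_mul, abs_of_nonneg (Finset.prod_nonneg fun p _ => hf0 _)]
          ring
    _ = ∫ x, H (T x) ∂(volume.prod volume) := (integral_prod _ hHT).symm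
    _ = |A.det| * ∫ ω, H ω := by
        rw [← integral_map hTm.aemeasurable, hTmap, integral_smul_measure,
          ENNReal.toReal_ofReal (abs_nonneg _), smul_eq_mul]
        rw [hTmap]
        exact hH.aestronglyMeasurable.smul_measure _
    _ = _ := by rw [hHint, mul_assoc]
end
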